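/- There exist an integer k ≥ 0 and a ℤ_p-submodule E of ⊕_{0≤i≤k} ((ℤ_p^n)^{⊕n})^{⊗i} which is a direct summand, is stable under the action of G(ℤ_p), and is such that for every commutative ℤ_p-algebra R and every g ∈ GL_n(R): g ∈ G(R) if and only if the automorphism of ⊕_{0≤i≤k} ((R^n)^{⊕n})^{⊗i} induced by g maps the R-submodule generated by the image of E onto itself. -/

import Mathlib

universe u

open scoped TensorProduct DirectSum

/-- Membership in `G(R)`: a matrix `m ∈ M_n(R)` lies in `G(R)` iff every `f ∈ I` vanishes
when evaluated (over `R`) at the entries of `m`. -/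
def Gmem {p : ℕ} [Fact p.Prime] {n : ℕ} (I : Ideal (MvPolynomial (Fin n × Fin n) ℤ_[p]))
    (R : Type u) [CommRing R] [Algebra ℤ_[p] R] (m : Matrix (Fin n) (Fin n) R) : Prop :=
  ∀ f ∈ I, MvPolynomial.aeval (fun ij : Fin n × Fin n => m ij.1 ij.2) f = 0

/-- The standard action of a matrix `m ∈ M_n(R)` on `U_R = (R^n)^{⊕n}`
(the standard action on each summand). -/
noncomputable def actU (R : Type u) [CommRing R] (n : ℕ) (m : Matrix (Fin n) (Fin n) R) :
    (Fin n → Fin n → R) →ₗ[R] (Fin n → Fin n → R) :=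
  LinearMap.pi fun j => (Matrix.mulVecLin m).comp (LinearMap.proj j)

/-- The endomorphism of `⊕_{0≤i≤k} ((R^n)^{⊕n})^{⊗i}` induced (diagonally on each tensor
power, componentwise on the direct sum) by a matrix `m ∈ M_n(R)` acting on `(R^n)^{⊕n}`. -/
noncomputable def actV (R : Type u) [CommRing R] (n k : ℕ) (m : Matrix (Fin n) (Fin n) R) :
    (⨁ i : Fin (k + 1), ⨂[R]^(i : ℕ) (Fin n → Fin n → R)) →ₗ[R]
      (⨁ i : Fin (k + 1), ⨂[R]^(i : ℕ) (Fin n → Fin n → R)) :=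
  DirectSum.toModule R (Fin (k + 1)) _ fun i =>
    (DirectSum.lof R (Fin (k + 1)) (fun i : Fin (k + 1) => ⨂[R]^(i : ℕ) (Fin n → Fin n → R))
        i).comp
      (PiTensorProduct.map fun _ => actU R n m)

/-- Componentwise base change `(ℤ_[p]^n)^{⊕n} → (R^n)^{⊕n}` (a `ℤ_[p]`-linear map). -/
noncomputable def bcU {p : ℕ} [Fact p.Prime] (R : Type u) [CommRing R] [Algebra ℤ_[p] R]
    (n : ℕ) : (Fin n → Fin n → ℤ_[p]) →ₗ[ℤ_[p]] (Fin n → Fin n → R) :=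
  ((Algebra.linearMap ℤ_[p] R).compLeft (Fin n)).compLeft (Fin n)

/-- Base change on `i`-th tensor powers, `((ℤ_[p]^n)^{⊕n})^{⊗i} → ((R^n)^{⊕n})^{⊗i}`. -/
noncomputable def bcPow {p : ℕ} [Fact p.Prime] (R : Type u) [CommRing R] [Algebra ℤ_[p] R]
    (n i : ℕ) :
    (⨂[ℤ_[p]]^i (Fin n → Fin n → ℤ_[p])) →ₗ[ℤ_[p]] (⨂[R]^i (Fin n → Fin n → R)) :=
  PiTensorProduct.lift
    (((PiTensorProduct.tprod R (s := fun _ : Fin i => (Fin n → Fin n → R))).restrictScalars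
        ℤ_[p]).compLinearMap fun _ => bcU R n)

/-- The canonical base-change map
`⊕_{0≤i≤k} ((ℤ_[p]^n)^{⊕n})^{⊗i} → ⊕_{0≤i≤k} ((R^n)^{⊕n})^{⊗i}`. -/
noncomputable def bcV {p : ℕ} [Fact p.Prime] (R : Type u) [CommRing R] [Algebra ℤ_[p] R]
    (n k : ℕ) :
    (⨁ i : Fin (k + 1), ⨂[ℤ_[p]]^(i : ℕ) (Fin n → Fin n → ℤ_[p])) →ₗ[ℤ_[p]]
      (⨁ i : Fin (k + 1), ⨂[R]^(i : ℕ) (Fin n → Fin n → R)) :=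
  DirectSum.toModule ℤ_[p] (Fin (k + 1)) _ fun i =>
    (DirectSum.lof ℤ_[p] (Fin (k + 1))
        (fun i : Fin (k + 1) => ⨂[R]^(i : ℕ) (Fin n → Fin n → R)) i).comp
      (bcPow R n (i : ℕ))
/-- A submodule of a module over a ring is everything as soon as each linear map vanishing on it
vanishes. -/
theorem Submodule.eq_top_of_forall_linearMap_eq_zero {R : Type*} {W : Type u} [CommRing R]
    [AddCommMonoid W] [Module R W] {S : Submodule R W}
    (h : ∀ (Q : Type u) [AddCommMonoid Q] [Module R Q] (q : W →ₗ[R] Q),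
      (∀ x ∈ S, q x = 0) → q = 0) : S = ⊤ := by
  let : AddCommGroup W := Module.addCommMonoidToAddCommGroup R
  rw [← S.ker_mkQ, h _ S.mkQ (by simp), LinearMap.ker_zero]

theorem LinearMap.exists_isCompl_ker_of_surjective {R W N : Type*} [CommRing R]
    [AddCommMonoid W] [Module R W] [AddCommGroup N] [Module R N] [Module.Projective R N]
    (q : W →ₗ[R] N) (hq : Function.Surjective q) : ∃ C, IsCompl (LinearMap.ker q) C := by
  let : AddCommGroup W := Module.addCommMonoidToAddCommGroup R
  obtain ⟨s, hs⟩ := q.exists_rightInverse_of_surjective (LinearMap.range_eq_top.mpr hq)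
  have hs' : ∀ x, q (s x) = x := LinearMap.congr_fun hs
  refine ⟨LinearMap.range s, ?_, ?_⟩
  · rw [Submodule.disjoint_def]
    rintro _ hx ⟨y, rfl⟩
    rw [LinearMap.mem_ker, hs'] at hx
    simp [hx]
  · rw [codisjoint_iff, eq_top_iff]
    intro x _
    rw [Submodule.mem_sup]
    exact ⟨x - s (q x), by simp [hs'], s (q x), ⟨_, rfl⟩, by simp⟩

/-- If `π'` is a base change of `π`, with compatible partial sections `s` and `s'`, then an element
whose image is generated by the image of `J` is itself generated by the image of any `E` that
contains `ker π` and `s '' J`. -/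
theorem Submodule.mem_span_image_of_section {Z R W W' A A' : Type*} [CommRing Z] [CommRing R]
    [Algebra Z R] [AddCommMonoid W] [Module Z W] [AddCommMonoid W'] [Module Z W'] [Module R W']
    [IsScalarTower Z R W']
    [AddCommMonoid A] [Module Z A] [AddCommMonoid A'] [Module R A']
    (b : W →ₗ[Z] W') (π : W →ₗ[Z] A) (π' : W' →ₗ[R] A') (m : A → A')
    (hm : ∀ w, π' (b w) = m (π w)) (s : A →ₗ[Z] W) (s' : A' →ₗ[R] W')
    (hs' : ∀ a, s' (m a) = b (s a)) (hs : ∀ w, π (s (π w)) = π w)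
    (hb : Submodule.span R (Set.range b) = ⊤) (E : Submodule Z W) (J : Set A)
    (hker : LinearMap.ker π ≤ E) (hJ : ∀ f ∈ J, s f ∈ E) (y : W')
    (hy : π' y ∈ Submodule.span R (m '' J)) : y ∈ Submodule.span R (b '' E) := by
  let : AddCommGroup W := Module.addCommMonoidToAddCommGroup Z
  let : AddCommGroup W' := Module.addCommMonoidToAddCommGroup R
  let : AddCommGroup A := Module.addCommMonoidToAddCommGroup Z
  have h₁ : s' (π' y) ∈ Submodule.span R (b '' E) := by
    suffices h : Submodule.span R (m '' J) ≤ (Submodule.span R (b '' E)).comap s' from h hy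
    rw [Submodule.span_le]
    rintro _ ⟨f, hf, rfl⟩
    exact Submodule.subset_span ⟨s f, hJ f hf, (hs' f).symm⟩
  have h₂ : Submodule.span R (Set.range b) ≤
      (Submodule.span R (b '' E)).comap (LinearMap.id - s'.comp π') := by
    rw [Submodule.span_le]
    rintro _ ⟨w, rfl⟩
    refine Submodule.subset_span ⟨w - s (π w), hker ?_, ?_⟩
    · simp [hs]
    · simp [hm, hs']
  have h₃ : y - s' (π' y) ∈ Submodule.span R (b '' E) := h₂ (hb ▸ Submodule.mem_top : y ∈ _)
  simpa using add_mem h₃ h₁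

open MvPolynomial in
/-- The linear form `∑ v j l • X (j, l)` attached to a vector `v` of `(R^n)^{⊕n}`. -/
noncomputable def linForm (R : Type*) [CommRing R] (n : ℕ) :
    (Fin n → Fin n → R) →ₗ[R] MvPolynomial (Fin n × Fin n) R where
  toFun v := ∑ j, ∑ l, v j l • X (j, l)
  map_add' v w := by simp [add_smul, Finset.sum_add_distrib]
  map_smul' c v := by simp [Finset.smul_sum, smul_smul]

open MvPolynomial in
theorem linForm_single (R : Type*) [CommRing R] (n : ℕ) (a b : Fin n) :
    linForm R n (Pi.single a (Pi.single b 1)) = X (a, b) := by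
  simp only [linForm, LinearMap.coe_mk, AddHom.coe_mk]
  rw [Finset.sum_eq_single a, Finset.sum_eq_single b] <;> simp +contextual [Pi.single_apply]

/-- Multiplication of linear forms on the `i`-th tensor power. -/
noncomputable def powToPoly (R : Type*) [CommRing R] (n i : ℕ) :
    (⨂[R]^i (Fin n → Fin n → R)) →ₗ[R] MvPolynomial (Fin n × Fin n) R :=
  PiTensorProduct.lift ((MultilinearMap.mkPiAlgebra R (Fin i) (MvPolynomial (Fin n × Fin n) R)
    ).compLinearMap fun _ => linForm R n)

theorem powToPoly_tprod (R : Type*) [CommRing R] (n i : ℕ) (v : Fin i → Fin n → Fin n → R) :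
    powToPoly R n i (PiTensorProduct.tprod R v) = ∏ j, linForm R n (v j) := by
  simp [powToPoly]

/-- The polynomial attached to an element of the truncated tensor algebra. -/
noncomputable def toPoly (R : Type*) [CommRing R] (n k : ℕ) :
    (⨁ i : Fin (k + 1), ⨂[R]^(i : ℕ) (Fin n → Fin n → R)) →ₗ[R]
      MvPolynomial (Fin n × Fin n) R :=
  DirectSum.toModule R (Fin (k + 1)) _ fun i => powToPoly R n i

theorem toPoly_lof (R : Type*) [CommRing R] (n k : ℕ) (i : Fin (k + 1))
    (t : ⨂[R]^(i : ℕ) (Fin n → Fin n → R)) :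
    toPoly R n k (DirectSum.lof R (Fin (k + 1))
      (fun i : Fin (k + 1) => ⨂[R]^(i : ℕ) (Fin n → Fin n → R)) i t) = powToPoly R n i t := by
  simp [toPoly]

open MvPolynomial in
/-- Right translation `f(X) ↦ f(X m)` on polynomial functions of a matrix. -/
noncomputable def rightTranslate {R : Type*} [CommRing R] {n : ℕ} (m : Matrix (Fin n) (Fin n) R) :
    MvPolynomial (Fin n × Fin n) R →ₐ[R] MvPolynomial (Fin n × Fin n) R :=
  aeval fun ij => ∑ l, m l ij.2 • X (ij.1, l)

theorem linForm_actU (R : Type*) [CommRing R] (n : ℕ) (m : Matrix (Fin n) (Fin n) R)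
    (v : Fin n → Fin n → R) :
    linForm R n (actU R n m v) = rightTranslate m (linForm R n v) := by
  simp only [linForm, actU, rightTranslate, LinearMap.coe_mk, AddHom.coe_mk, LinearMap.pi_apply,
    LinearMap.comp_apply, LinearMap.proj_apply, Matrix.mulVecLin_apply, Matrix.mulVec,
    dotProduct, map_sum, map_smul, MvPolynomial.aeval_X, Finset.sum_smul, Finset.smul_sum,
    smul_smul]
  refine Finset.sum_congr rfl fun j _ => ?_
  rw [Finset.sum_comm]
  simp only [mul_comm]

theorem toPoly_actV (R : Type*) [CommRing R] (n k : ℕ) (m : Matrix (Fin n) (Fin n) R)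
    (t : ⨁ i : Fin (k + 1), ⨂[R]^(i : ℕ) (Fin n → Fin n → R)) :
    toPoly R n k (actV R n k m t) = rightTranslate m (toPoly R n k t) := by
  suffices h : (toPoly R n k).comp (actV R n k m) =
      (rightTranslate m).toLinearMap.comp (toPoly R n k) from LinearMap.congr_fun h t
  refine DirectSum.linearMap_ext R fun i => PiTensorProduct.ext (MultilinearMap.ext fun v => ?_)
  simp [actV, toPoly_lof, powToPoly_tprod, linForm_actU, PiTensorProduct.map_tprod]

theorem actV_mul (R : Type*) [CommRing R] (n k : ℕ) (a b : Matrix (Fin n) (Fin n) R)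
    (t : ⨁ i : Fin (k + 1), ⨂[R]^(i : ℕ) (Fin n → Fin n → R)) :
    actV R n k (a * b) t = actV R n k a (actV R n k b t) := by
  suffices h : actV R n k (a * b) = (actV R n k a).comp (actV R n k b) from
    LinearMap.congr_fun h t
  have hU : actU R n (a * b) = (actU R n a).comp (actU R n b) := by
    ext; simp [actU]
  refine DirectSum.linearMap_ext R fun i => PiTensorProduct.ext (MultilinearMap.ext fun v => ?_)
  simp [actV, hU, PiTensorProduct.map_tprod]

theorem actV_one (R : Type*) [CommRing R] (n k : ℕ)
    (t : ⨁ i : Fin (k + 1), ⨂[R]^(i : ℕ) (Fin n → Fin n → R)) :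
    actV R n k 1 t = t := by
  suffices h : actV R n k 1 = LinearMap.id from LinearMap.congr_fun h t
  have hU : actU R n 1 = LinearMap.id := by
    ext; simp [actU]
  refine DirectSum.linearMap_ext R fun i => PiTensorProduct.ext (MultilinearMap.ext fun v => ?_)
  simp [actV, hU]

section BaseChange

variable {p : ℕ} [Fact p.Prime] (R : Type*) [CommRing R] [Algebra ℤ_[p] R] (n k : ℕ)

theorem bcV_lof_tprod (i : Fin (k + 1)) (v : Fin i → Fin n → Fin n → ℤ_[p]) :
    bcV R n k (DirectSum.lof ℤ_[p] (Fin (k + 1))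
      (fun i : Fin (k + 1) => ⨂[ℤ_[p]]^(i : ℕ) (Fin n → Fin n → ℤ_[p])) i
        (PiTensorProduct.tprod ℤ_[p] v)) =
      DirectSum.lof R (Fin (k + 1)) (fun i : Fin (k + 1) => ⨂[R]^(i : ℕ) (Fin n → Fin n → R)) i
        (PiTensorProduct.tprod R fun j => bcU R n (v j)) := by
  simp [bcV, bcPow]
  rfl

theorem linForm_bcU (v : Fin n → Fin n → ℤ_[p]) :
    linForm R n (bcU R n v) = MvPolynomial.map (algebraMap ℤ_[p] R) (linForm ℤ_[p] n v) := by
  simp [linForm, bcU, MvPolynomial.smul_eq_C_mul]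

theorem toPoly_bcV (t : ⨁ i : Fin (k + 1), ⨂[ℤ_[p]]^(i : ℕ) (Fin n → Fin n → ℤ_[p])) :
    toPoly R n k (bcV R n k t) =
      MvPolynomial.map (algebraMap ℤ_[p] R) (toPoly ℤ_[p] n k t) := by
  suffices h : ((toPoly R n k).restrictScalars ℤ_[p]).comp (bcV R n k) =
      (MvPolynomial.mapAlgHom (Algebra.ofId ℤ_[p] R)).toLinearMap.comp (toPoly ℤ_[p] n k) from
    LinearMap.congr_fun h t
  refine DirectSum.linearMap_ext ℤ_[p] fun i =>
    PiTensorProduct.ext (MultilinearMap.ext fun v => ?_)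
  simp [bcV_lof_tprod, toPoly_lof, powToPoly_tprod, linForm_bcU]

theorem span_range_bcV : Submodule.span R (Set.range (bcV (p := p) R n k)) = ⊤ := by
  refine Submodule.eq_top_of_forall_linearMap_eq_zero fun Q _ _ q hq => ?_
  refine DirectSum.linearMap_ext R fun i => PiTensorProduct.ext
    (Module.Basis.ext_multilinear (fun _ => Pi.basis fun _ : Fin n => Pi.basisFun R (Fin n))
      fun w => ?_)
  have hb : ∀ x : (_ : Fin n) × Fin n, (Pi.basis fun _ : Fin n => Pi.basisFun R (Fin n)) x =
      bcU (p := p) R n (Pi.single x.1 (Pi.single x.2 1)) := by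
    rintro ⟨a, b⟩
    ext j l
    by_cases h : j = a
    · subst h
      by_cases h' : l = b
      · subst h'; simp [bcU]
      · simp [bcU, h']
    · simp [bcU, h]
  simp only [hb]
  simp only [LinearMap.compMultilinearMap_apply, LinearMap.comp_apply, ← bcV_lof_tprod]
  simpa using hq _ (Submodule.subset_span ⟨_, rfl⟩)

theorem bcV_self (t : ⨁ i : Fin (k + 1), ⨂[ℤ_[p]]^(i : ℕ) (Fin n → Fin n → ℤ_[p])) :
    bcV ℤ_[p] n k t = t := by
  suffices h : bcV (p := p) ℤ_[p] n k = LinearMap.id from LinearMap.congr_fun h t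
  refine DirectSum.linearMap_ext ℤ_[p] fun i =>
    PiTensorProduct.ext (MultilinearMap.ext fun v => ?_)
  simp [bcV_lof_tprod]
  rfl

end BaseChange

open MvPolynomial in
theorem totalDegree_toPoly_le (R : Type*) [CommRing R] (n k : ℕ)
    (t : ⨁ i : Fin (k + 1), ⨂[R]^(i : ℕ) (Fin n → Fin n → R)) :
    toPoly R n k t ∈ restrictTotalDegree (Fin n × Fin n) R k := by
  suffices h : (restrictTotalDegree (Fin n × Fin n) R k).mkQ.comp (toPoly R n k) = 0 by
    simpa using LinearMap.congr_fun h t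
  refine DirectSum.linearMap_ext R fun i => PiTensorProduct.ext (MultilinearMap.ext fun v => ?_)
  simp only [LinearMap.compMultilinearMap_apply, LinearMap.comp_apply, toPoly_lof,
    powToPoly_tprod, LinearMap.zero_apply, Submodule.mkQ_apply, Submodule.Quotient.mk_eq_zero,
    mem_restrictTotalDegree]
  have hlin : ∀ v : Fin n → Fin n → R, (linForm R n v).totalDegree ≤ 1 := by
    intro v
    refine totalDegree_finsetSum_le fun j _ => totalDegree_finsetSum_le fun l _ => ?_
    refine (totalDegree_smul_le _ _).trans ?_
    refine (totalDegree_monomial_le _ _).trans ?_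
    simp
  refine (totalDegree_finsetProd _ _).trans ((Finset.sum_le_sum fun j _ => hlin (v j)).trans ?_)
  simpa using Nat.lt_succ_iff.mp i.2

open MvPolynomial in
theorem exists_prod_X_eq_monomial (R : Type*) [CommRing R] {σ : Type*} (i : ℕ) (d : σ →₀ ℕ)
    (hd : d.degree = i) : ∃ w : Fin i → σ, ∏ j, X (w j) = monomial d (1 : R) := by
  classical
  induction i generalizing d with
  | zero =>
    refine ⟨Fin.elim0, ?_⟩
    rw [Finsupp.degree_eq_zero_iff] at hd
    simp [hd]
  | succ i ih =>
    obtain ⟨a, ha⟩ : ∃ a, d a ≠ 0 := by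
      by_contra! h
      have : d = 0 := Finsupp.ext h
      simp [this] at hd
    have hle : Finsupp.single a 1 ≤ d := by
      simpa [Finsupp.single_le_iff] using Nat.one_le_iff_ne_zero.mpr ha
    obtain ⟨e, rfl⟩ := exists_add_of_le hle
    obtain ⟨w, hw⟩ := ih e (by simp at hd; omega)
    refine ⟨Fin.cons a w, ?_⟩
    rw [Fin.prod_univ_succ]
    simp only [Fin.cons_zero, Fin.cons_succ, hw]
    simp [X]

open MvPolynomial in
theorem exists_toPoly_eq_monomial (R : Type*) [CommRing R] (n k : ℕ) (d : Fin n × Fin n →₀ ℕ)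
    (hd : d.degree ≤ k) : ∃ t, toPoly R n k t = monomial d 1 := by
  obtain ⟨w, hw⟩ := exists_prod_X_eq_monomial R d.degree d rfl
  refine ⟨DirectSum.lof R (Fin (k + 1)) (fun i : Fin (k + 1) => ⨂[R]^(i : ℕ) (Fin n → Fin n → R))
    ⟨d.degree, Nat.lt_succ_iff.mpr hd⟩
    (PiTensorProduct.tprod R fun j => Pi.single (w j).1 (Pi.single (w j).2 1)), ?_⟩
  rw [toPoly_lof, powToPoly_tprod]
  simpa [linForm_single] using hw

open MvPolynomial in
/-- Compatible partial sections of `toPoly` over `ℤ_[p]` and over `R`, valid up to degree `k`. -/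
theorem exists_section_toPoly {p : ℕ} [Fact p.Prime] (R : Type*) [CommRing R] [Algebra ℤ_[p] R]
    (n k : ℕ) : ∃ (s : MvPolynomial (Fin n × Fin n) ℤ_[p] →ₗ[ℤ_[p]]
        (⨁ i : Fin (k + 1), ⨂[ℤ_[p]]^(i : ℕ) (Fin n → Fin n → ℤ_[p])))
      (s' : MvPolynomial (Fin n × Fin n) R →ₗ[R]
        (⨁ i : Fin (k + 1), ⨂[R]^(i : ℕ) (Fin n → Fin n → R))),
      (∀ f ∈ restrictTotalDegree (Fin n × Fin n) ℤ_[p] k, toPoly ℤ_[p] n k (s f) = f) ∧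
      ∀ f, s' (map (algebraMap ℤ_[p] R) f) = bcV R n k (s f) := by
  have ht : ∀ d : Fin n × Fin n →₀ ℕ, ∃ t, d.degree ≤ k → toPoly ℤ_[p] n k t = monomial d 1 := by
    intro d
    by_cases hd : d.degree ≤ k
    · obtain ⟨t, ht⟩ := exists_toPoly_eq_monomial ℤ_[p] n k d hd
      exact ⟨t, fun _ => ht⟩
    · exact ⟨0, fun h => absurd h hd⟩
  choose t ht using ht
  have hs : ∀ d, (basisMonomials (Fin n × Fin n) ℤ_[p]).constr ℕ t (monomial d 1) = t d := by
    intro d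
    rw [← (basisMonomials (Fin n × Fin n) ℤ_[p]).constr_basis ℕ t d, coe_basisMonomials]
  have hs' : ∀ d, (basisMonomials (Fin n × Fin n) R).constr ℕ (fun d => bcV R n k (t d))
      (monomial d 1) = bcV R n k (t d) := by
    intro d
    rw [← (basisMonomials (Fin n × Fin n) R).constr_basis ℕ (fun d => bcV R n k (t d)) d,
      coe_basisMonomials]
  refine ⟨(basisMonomials _ ℤ_[p]).constr ℕ t,
    (basisMonomials _ R).constr ℕ fun d => bcV R n k (t d), fun f hf => ?_, fun f => ?_⟩
  · rw [mem_restrictTotalDegree] at hf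
    conv_rhs => rw [f.as_sum]
    conv_lhs => rw [f.as_sum]
    rw [map_sum, map_sum]
    refine Finset.sum_congr rfl fun d hd => ?_
    have hdk : d.degree ≤ k := (le_totalDegree hd).trans hf
    rw [← mul_one (coeff d f), ← smul_eq_mul, ← smul_monomial, map_smul, map_smul, hs, ht d hdk]
  · induction f using MvPolynomial.induction_on' with
    | monomial d c =>
      have h₁ : monomial d c = c • monomial d 1 := by
        rw [smul_monomial, smul_eq_mul, mul_one]
      have h₂ : monomial d (algebraMap _ R c) = algebraMap _ R c • monomial d 1 := by
        rw [smul_monomial, smul_eq_mul, mul_one]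
      rw [map_monomial, h₂, map_smul, hs', h₁, map_smul, hs, map_smul, algebraMap_smul]
    | add f g hf hg => simp only [map_add, hf, hg]

section Comultiplication

variable {p : ℕ} [Fact p.Prime] {n : ℕ}

open MvPolynomial

theorem Gmem.map {I : Ideal (MvPolynomial (Fin n × Fin n) ℤ_[p])} {R S : Type*}
    [CommRing R] [Algebra ℤ_[p] R] [CommRing S] [Algebra ℤ_[p] S] (φ : R →ₐ[ℤ_[p]] S)
    {m : Matrix (Fin n) (Fin n) R} (hm : Gmem I R m) : Gmem I S (m.map φ) := by
  intro f hf
  have h := congrArg φ (hm f hf)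
  rw [map_zero, ← AlgHom.comp_apply, comp_aeval] at h
  exact h

/-- Closure under multiplication over the algebras of an arbitrary universe gives closure under
multiplication over the algebras of the lowest universe. -/
theorem Gmem.mul_of_type {I : Ideal (MvPolynomial (Fin n × Fin n) ℤ_[p])}
    (hmul : ∀ (R : Type u) [CommRing R] [Algebra ℤ_[p] R]
      (m m' : Matrix (Fin n) (Fin n) R), Gmem I R m → Gmem I R m' → Gmem I R (m * m'))
    {S : Type} [CommRing S] [Algebra ℤ_[p] S] {m m' : Matrix (Fin n) (Fin n) S}
    (hm : Gmem I S m) (hm' : Gmem I S m') : Gmem I S (m * m') := by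
  let e : ULift.{u} S ≃ₐ[ℤ_[p]] S := ULift.algEquiv
  have h := (hmul _ _ _ (hm.map (e.symm : S →ₐ[ℤ_[p]] ULift.{u} S))
    (hm'.map (e.symm : S →ₐ[ℤ_[p]] ULift.{u} S))).map (e : ULift.{u} S →ₐ[ℤ_[p]] S)
  rw [Matrix.map_mul] at h
  convert h using 2 <;> ext <;> simp

/-- The comultiplication `f ↦ f(X Y)` on polynomial functions of a matrix. -/
noncomputable def matrixComul (K : Type*) [CommRing K] (n : ℕ) :
    MvPolynomial (Fin n × Fin n) K →ₐ[K]
      MvPolynomial (Fin n × Fin n) K ⊗[K] MvPolynomial (Fin n × Fin n) K :=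
  aeval fun ij => ∑ l, X (ij.1, l) ⊗ₜ X (l, ij.2)

/-- The span of the tensors whose two factors have total degree at most `k`. -/
noncomputable def degreeLESpan (K σ : Type*) [CommRing K] (k : ℕ) :
    Submodule K (MvPolynomial σ K ⊗[K] MvPolynomial σ K) :=
  Submodule.span K {t | ∃ u ∈ restrictTotalDegree σ K k, ∃ v ∈ restrictTotalDegree σ K k,
    u ⊗ₜ v = t}

theorem mul_mem_degreeLESpan {K σ : Type*} [CommRing K] {a b : ℕ}
    {x y : MvPolynomial σ K ⊗[K] MvPolynomial σ K} (hx : x ∈ degreeLESpan K σ a)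
    (hy : y ∈ degreeLESpan K σ b) : x * y ∈ degreeLESpan K σ (a + b) := by
  have h := Submodule.mul_mem_mul hx hy
  rw [degreeLESpan, degreeLESpan, Submodule.span_mul_span] at h
  refine Submodule.span_mono ?_ h
  rintro _ ⟨_, ⟨u, hu, v, hv, rfl⟩, _, ⟨u', hu', v', hv', rfl⟩, rfl⟩
  rw [mem_restrictTotalDegree] at hu hu' hv hv'
  exact ⟨u * u',
    (mem_restrictTotalDegree _ _ _).mpr ((totalDegree_mul _ _).trans (add_le_add hu hu')),
    v * v', (mem_restrictTotalDegree _ _ _).mpr ((totalDegree_mul _ _).trans (add_le_add hv hv')),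
    by simp⟩

theorem degreeLESpan_mono {K σ : Type*} [CommRing K] {a b : ℕ} (hab : a ≤ b) :
    degreeLESpan K σ a ≤ degreeLESpan K σ b := by
  refine Submodule.span_mono ?_
  rintro _ ⟨u, hu, v, hv, rfl⟩
  rw [mem_restrictTotalDegree] at hu hv
  exact ⟨u, (mem_restrictTotalDegree _ _ _).mpr (hu.trans hab),
    v, (mem_restrictTotalDegree _ _ _).mpr (hv.trans hab), rfl⟩

theorem matrixComul_mem_degreeLESpan {K : Type*} [CommRing K] {n k : ℕ}
    {f : MvPolynomial (Fin n × Fin n) K} (hf : f.totalDegree ≤ k) :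
    matrixComul K n f ∈ degreeLESpan K (Fin n × Fin n) k := by
  have hX : ∀ ij : Fin n × Fin n,
      matrixComul K n (X ij) ∈ degreeLESpan K (Fin n × Fin n) 1 := by
    intro ij
    rw [matrixComul, aeval_X]
    have hX1 : ∀ ij : Fin n × Fin n, (X ij : MvPolynomial (Fin n × Fin n) K) ∈
        restrictTotalDegree (Fin n × Fin n) K 1 := by
      intro ij
      rw [mem_restrictTotalDegree]
      refine (totalDegree_monomial_le _ _).trans ?_
      simp
    exact sum_mem fun l _ => Submodule.subset_span ⟨_, hX1 _, _, hX1 _, rfl⟩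
  have hprod : ∀ (i : ℕ) (w : Fin i → Fin n × Fin n),
      ∏ j, matrixComul K n (X (w j)) ∈ degreeLESpan K (Fin n × Fin n) i := by
    intro i
    induction i with
    | zero =>
      intro w
      refine Submodule.subset_span ⟨1, ?_, 1, ?_, by simp [Algebra.TensorProduct.one_def]⟩ <;>
        simp [mem_restrictTotalDegree]
    | succ i ih =>
      intro w
      rw [Fin.prod_univ_succ, mul_comm]
      exact mul_mem_degreeLESpan (ih _) (hX _)
  rw [f.as_sum, map_sum]
  refine sum_mem fun d hd => ?_
  obtain ⟨w, hw⟩ := exists_prod_X_eq_monomial K d.degree d rfl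
  have h₁ : monomial d (coeff d f) = coeff d f • monomial d 1 := by
    rw [smul_monomial, smul_eq_mul, mul_one]
  rw [h₁, map_smul, ← hw, map_prod]
  exact Submodule.smul_mem _ _ (degreeLESpan_mono ((le_totalDegree hd).trans hf) (hprod _ w))

/-- Comultiplication followed by evaluation of the second factor is right translation. -/
theorem rightTranslate_map {R : Type*} [CommRing R] [Algebra ℤ_[p] R]
    (g : Matrix (Fin n) (Fin n) R) (f : MvPolynomial (Fin n × Fin n) ℤ_[p]) :
    rightTranslate g (map (algebraMap ℤ_[p] R) f) =
      Algebra.TensorProduct.lift (mapAlgHom (Algebra.ofId ℤ_[p] R))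
        ((Algebra.ofId R (MvPolynomial (Fin n × Fin n) R)).restrictScalars ℤ_[p] |>.comp
          (aeval fun ij : Fin n × Fin n => g ij.1 ij.2)) (fun _ _ => Commute.all _ _)
        (matrixComul ℤ_[p] n f) := by
  suffices h : ((rightTranslate g).restrictScalars ℤ_[p]).comp (mapAlgHom (Algebra.ofId ℤ_[p] R)) =
      (Algebra.TensorProduct.lift (mapAlgHom (Algebra.ofId ℤ_[p] R))
        ((Algebra.ofId R (MvPolynomial (Fin n × Fin n) R)).restrictScalars ℤ_[p] |>.comp
          (aeval fun ij : Fin n × Fin n => g ij.1 ij.2)) (fun _ _ => Commute.all _ _)).comp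
        (matrixComul ℤ_[p] n) from AlgHom.congr_fun h f
  refine algHom_ext fun ij => ?_
  simp [rightTranslate, matrixComul, Algebra.ofId_apply, smul_eq_C_mul, mul_comm]

theorem rightTranslate_eval_one {R : Type*} [CommRing R] [Algebra ℤ_[p] R]
    (g : Matrix (Fin n) (Fin n) R) (f : MvPolynomial (Fin n × Fin n) ℤ_[p]) :
    aeval (fun ij : Fin n × Fin n => (1 : Matrix (Fin n) (Fin n) R) ij.1 ij.2)
        (rightTranslate g (map (algebraMap ℤ_[p] R) f)) =
      aeval (fun ij : Fin n × Fin n => g ij.1 ij.2) f := by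
  suffices h : (((aeval fun ij : Fin n × Fin n =>
      (1 : Matrix (Fin n) (Fin n) R) ij.1 ij.2).comp (rightTranslate g)).restrictScalars
        ℤ_[p]).comp (mapAlgHom (Algebra.ofId ℤ_[p] R)) =
      (aeval fun ij : Fin n × Fin n => g ij.1 ij.2) from AlgHom.congr_fun h f
  refine algHom_ext fun ij => ?_
  simp [rightTranslate, Matrix.one_apply]

/-- If the zero locus of `I` is closed under multiplication, then the comultiplication maps `I`
to the kernel of `A ⊗ A → (A ⧸ I) ⊗ (A ⧸ I)`. -/
theorem map_mk_matrixComul_eq_zero {I : Ideal (MvPolynomial (Fin n × Fin n) ℤ_[p])}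
    (hmul : ∀ (R : Type u) [CommRing R] [Algebra ℤ_[p] R]
      (m m' : Matrix (Fin n) (Fin n) R), Gmem I R m → Gmem I R m' → Gmem I R (m * m'))
    {f : MvPolynomial (Fin n × Fin n) ℤ_[p]} (hf : f ∈ I) :
    Algebra.TensorProduct.map (Ideal.Quotient.mkₐ ℤ_[p] I) (Ideal.Quotient.mkₐ ℤ_[p] I)
      (matrixComul ℤ_[p] n f) = 0 := by
  set B := MvPolynomial (Fin n × Fin n) ℤ_[p] ⧸ I
  set x : Matrix (Fin n) (Fin n) B := Matrix.of fun i j => Ideal.Quotient.mkₐ ℤ_[p] I (X (i, j))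
  have hx : Gmem I B x := by
    intro f hf
    have h : (aeval fun ij : Fin n × Fin n => x ij.1 ij.2) = Ideal.Quotient.mkₐ ℤ_[p] I :=
      algHom_ext fun ij => by rw [aeval_X]; rfl
    rw [h]
    exact Ideal.Quotient.eq_zero_iff_mem.mpr hf
  have h := Gmem.mul_of_type hmul
    (hx.map (Algebra.TensorProduct.includeLeft : B →ₐ[ℤ_[p]] B ⊗[ℤ_[p]] B))
    (hx.map (S := B ⊗[ℤ_[p]] B) (Algebra.TensorProduct.includeRight : B →ₐ[ℤ_[p]] B ⊗[ℤ_[p]] B))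
    f hf
  rw [← h, ← AlgHom.comp_apply]
  refine AlgHom.congr_fun (algHom_ext fun ij => ?_) f
  simp [matrixComul, Matrix.mul_apply, x]

/-- The part of `I` of total degree at most `k`. -/
noncomputable def degreeLEPart (I : Ideal (MvPolynomial (Fin n × Fin n) ℤ_[p])) (k : ℕ) :
    Submodule ℤ_[p] (MvPolynomial (Fin n × Fin n) ℤ_[p]) :=
  I.restrictScalars ℤ_[p] ⊓ restrictTotalDegree (Fin n × Fin n) ℤ_[p] k

/-- Right translation by a point of `G` preserves the degree-bounded part of `I`. -/
theorem rightTranslate_mem_span {I : Ideal (MvPolynomial (Fin n × Fin n) ℤ_[p])}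
    [Module.Flat ℤ_[p] (MvPolynomial (Fin n × Fin n) ℤ_[p] ⧸ I)]
    (hmul : ∀ (R : Type u) [CommRing R] [Algebra ℤ_[p] R]
      (m m' : Matrix (Fin n) (Fin n) R), Gmem I R m → Gmem I R m' → Gmem I R (m * m'))
    {R : Type*} [CommRing R] [Algebra ℤ_[p] R] {g : Matrix (Fin n) (Fin n) R} (hg : Gmem I R g)
    {k : ℕ} {f : MvPolynomial (Fin n × Fin n) ℤ_[p]} (hf : f ∈ degreeLEPart I k) :
    rightTranslate g (map (algebraMap ℤ_[p] R) f) ∈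
      Submodule.span R (map (algebraMap ℤ_[p] R) '' (degreeLEPart I k : Set _)) := by
  classical
  let A := MvPolynomial (Fin n × Fin n) ℤ_[p]
  let q : A →ₐ[ℤ_[p]] A ⧸ I := Ideal.Quotient.mkₐ ℤ_[p] I
  let T : Submodule ℤ_[p] A := restrictTotalDegree (Fin n × Fin n) ℤ_[p] k
  let N : Submodule ℤ_[p] (A ⧸ I) := T.map q.toLinearMap
  have : Module.Finite ℤ_[p] N := Module.Finite.map T q.toLinearMap
  let c := Module.Free.chooseBasis ℤ_[p] N
  have hC : ∀ i, ∃ C ∈ T, q C = c i := fun i => (c i).2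
  choose C hCT hC using hC
  obtain ⟨P, hP⟩ : ∃ P : A →ₗ[ℤ_[p]] T, ∀ x : T, P x = x := by
    obtain ⟨s, -, hs, -⟩ := exists_section_toPoly (p := p) ℤ_[p] n k
    exact ⟨(toPoly ℤ_[p] n k ∘ₗ s).codRestrict T fun x => totalDegree_toPoly_le _ _ _ _,
      fun x => Subtype.ext (hs x x.2)⟩
  let a : ∀ i, A →ₗ[ℤ_[p]] ℤ_[p] := fun i => c.coord i ∘ₗ
    (q.toLinearMap.submoduleMap T) ∘ₗ P
  have ha : ∀ h ∈ T, q h = ∑ i, a i h • q (C i) := by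
    intro h hh
    have := congrArg Subtype.val (c.sum_repr (q.toLinearMap.submoduleMap T ⟨h, hh⟩))
    simp only [Submodule.coe_sum, Submodule.coe_smul] at this
    simp only [hC]
    refine Eq.trans this.symm (Finset.sum_congr rfl fun i _ => ?_)
    simp [a, hP ⟨h, hh⟩]
  have hsmul : ∀ (r : ℤ_[p]) (x : A),
      map (algebraMap ℤ_[p] R) (r • x) = r • map (algebraMap ℤ_[p] R) x :=
    map_smul (mapAlgHom (Algebra.ofId ℤ_[p] R))
  let v : ∀ i, A ⊗[ℤ_[p]] A →ₗ[ℤ_[p]] A := fun i =>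
    TensorProduct.rid ℤ_[p] A ∘ₗ (a i).lTensor A
  have hspan : ∀ t ∈ degreeLESpan ℤ_[p] (Fin n × Fin n) k,
      (∀ i, v i t ∈ T) ∧
      Algebra.TensorProduct.lift (mapAlgHom (Algebra.ofId ℤ_[p] R))
        ((Algebra.ofId R (MvPolynomial (Fin n × Fin n) R)).restrictScalars ℤ_[p] |>.comp
          (aeval fun ij : Fin n × Fin n => g ij.1 ij.2)) (fun _ _ => Commute.all _ _) t =
        ∑ i, aeval (fun ij : Fin n × Fin n => g ij.1 ij.2) (C i) •
          map (algebraMap ℤ_[p] R) (v i t) ∧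
      Algebra.TensorProduct.map q q t = ∑ i, q (v i t) ⊗ₜ[ℤ_[p]] q (C i) := by
    intro t ht
    induction ht using Submodule.span_induction with
    | mem t ht =>
      obtain ⟨u, hu, h, hh, rfl⟩ := ht
      have hg' : aeval (fun ij : Fin n × Fin n => g ij.1 ij.2) h =
          ∑ i, a i h • aeval (fun ij : Fin n × Fin n => g ij.1 ij.2) (C i) := by
        have h₁ : h - ∑ i, a i h • C i ∈ I := by
          rw [← Ideal.Quotient.eq_zero_iff_mem]
          have h₂ := ha h hh
          simp only [← map_smul, ← map_sum] at h₂
          rw [map_sub, sub_eq_zero]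
          exact h₂
        have h₃ := hg _ h₁
        simpa [sub_eq_zero] using h₃
      refine ⟨fun i => ?_, ?_, ?_⟩
      · simpa [v] using T.smul_mem _ hu
      · rw [Algebra.TensorProduct.lift_tmul, AlgHom.comp_apply, hg', map_sum, Finset.mul_sum]
        refine Finset.sum_congr rfl fun i _ => ?_
        have hvi : v i (u ⊗ₜ h) = a i h • u := by simp [v]
        rw [hvi, hsmul, map_smul, mul_smul_comm, smul_comm, mul_comm,
          Algebra.smul_def (aeval _ (C i))]
        rfl
      · simp [v, ha h hh, TensorProduct.tmul_sum, TensorProduct.smul_tmul]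
    | zero => simp
    | add x y _ _ hx hy =>
      refine ⟨fun i => by simpa using add_mem (hx.1 i) (hy.1 i), ?_, ?_⟩
      · simp only [map_add, hx.2.1, hy.2.1, smul_add, Finset.sum_add_distrib]
      · simp only [map_add, hx.2.2, hy.2.2, TensorProduct.add_tmul, Finset.sum_add_distrib]
    | smul r x _ hx =>
      refine ⟨fun i => by simpa using T.smul_mem r (hx.1 i), ?_, ?_⟩
      · rw [map_smul, hx.2.1, Finset.smul_sum]
        refine Finset.sum_congr rfl fun i _ => ?_
        rw [map_smul, hsmul, smul_comm]
      · simp only [map_smul, hx.2.2, Finset.smul_sum, TensorProduct.smul_tmul']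
  obtain ⟨hT, hev, hmk⟩ := hspan _
    (matrixComul_mem_degreeLESpan ((mem_restrictTotalDegree _ _ _).mp hf.2))
  rw [map_mk_matrixComul_eq_zero hmul hf.1] at hmk
  have hv : ∀ i, q (v i (matrixComul ℤ_[p] n f)) = 0 := by
    have hinj := Module.Flat.lTensor_preserves_injective_linearMap (M := A ⧸ I) N.subtype
      N.subtype_injective
    have h₀ : ∑ i, q (v i (matrixComul ℤ_[p] n f)) ⊗ₜ[ℤ_[p]] c i = 0 := by
      apply hinj
      simpa [hC] using hmk.symm
    intro i
    have := TensorProduct.sum_tmul_basis_right_eq_zero c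
      (Finsupp.equivFunOnFinite.symm fun i => q (v i (matrixComul ℤ_[p] n f)))
      (by simpa [Finsupp.sum_fintype] using h₀)
    simpa using DFunLike.congr_fun this i
  rw [rightTranslate_map, hev]
  exact sum_mem fun i _ => Submodule.smul_mem _ _ (Submodule.subset_span
    ⟨_, ⟨Ideal.Quotient.eq_zero_iff_mem.mp (hv i), hT i⟩, rfl⟩)

end Comultiplication

open MvPolynomial in
theorem exists_degreeLEPart_generates {p : ℕ} [Fact p.Prime] {n : ℕ}
    (I : Ideal (MvPolynomial (Fin n × Fin n) ℤ_[p])) :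
    ∃ k, Ideal.span (degreeLEPart I k : Set (MvPolynomial (Fin n × Fin n) ℤ_[p])) = I := by
  obtain ⟨S, hS⟩ := (inferInstance :
    IsNoetherianRing (MvPolynomial (Fin n × Fin n) ℤ_[p])).noetherian I
  refine ⟨S.sup totalDegree, le_antisymm (Ideal.span_le.mpr fun f hf => hf.1) ?_⟩
  conv_lhs => rw [← hS]
  refine Ideal.span_mono fun f hf => ⟨?_, ?_⟩
  · change f ∈ I
    exact hS ▸ Submodule.subset_span hf
  · rw [SetLike.mem_coe, mem_restrictTotalDegree]
    exact Finset.le_sup hf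

/-- The tensors whose associated polynomial lies in `I`. -/
noncomputable def tensorPart {p : ℕ} [Fact p.Prime] {n : ℕ}
    (I : Ideal (MvPolynomial (Fin n × Fin n) ℤ_[p])) (k : ℕ) :
    Submodule ℤ_[p] (⨁ i : Fin (k + 1), ⨂[ℤ_[p]]^(i : ℕ) (Fin n → Fin n → ℤ_[p])) :=
  (I.restrictScalars ℤ_[p]).comap (toPoly ℤ_[p] n k)

section TensorPart

variable {p : ℕ} [Fact p.Prime] {n : ℕ} (I : Ideal (MvPolynomial (Fin n × Fin n) ℤ_[p])) (k : ℕ)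

open MvPolynomial

theorem exists_isCompl_tensorPart [Module.Flat ℤ_[p] (MvPolynomial (Fin n × Fin n) ℤ_[p] ⧸ I)] :
    ∃ C, IsCompl (tensorPart I k) C := by
  let q := (Ideal.Quotient.mkₐ ℤ_[p] I).toLinearMap ∘ₗ toPoly ℤ_[p] n k
  have : Module.Finite ℤ_[p] (LinearMap.range q) := Module.Finite.range q
  obtain ⟨C, hC⟩ := q.rangeRestrict.exists_isCompl_ker_of_surjective q.surjective_rangeRestrict
  have h : tensorPart I k = LinearMap.ker q.rangeRestrict := by
    ext t
    rw [LinearMap.ker_rangeRestrict]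
    exact Ideal.Quotient.eq_zero_iff_mem.symm
  exact ⟨C, h ▸ hC⟩

theorem mem_span_bcV_tensorPart_iff {R : Type*} [CommRing R] [Algebra ℤ_[p] R]
    (y : ⨁ i : Fin (k + 1), ⨂[R]^(i : ℕ) (Fin n → Fin n → R)) :
    y ∈ Submodule.span R (bcV (p := p) R n k '' (tensorPart I k : Set _)) ↔
      toPoly R n k y ∈
        Submodule.span R (map (algebraMap ℤ_[p] R) '' (degreeLEPart I k : Set _)) := by
  constructor
  · intro hy
    suffices h : Submodule.span R (bcV (p := p) R n k '' (tensorPart I k : Set _)) ≤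
        (Submodule.span R (map (algebraMap ℤ_[p] R) '' (degreeLEPart I k : Set _))).comap
          (toPoly R n k) from h hy
    rw [Submodule.span_le]
    rintro _ ⟨t, ht, rfl⟩
    exact Submodule.subset_span
      ⟨toPoly ℤ_[p] n k t, ⟨ht, totalDegree_toPoly_le _ _ _ _⟩, (toPoly_bcV R n k t).symm⟩
  · intro hy
    obtain ⟨s, s', hs, hs'⟩ := exists_section_toPoly (p := p) R n k
    refine Submodule.mem_span_image_of_section (bcV R n k) (toPoly ℤ_[p] n k) (toPoly R n k)
      (map (algebraMap ℤ_[p] R)) (toPoly_bcV R n k) s s' hs'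
      (fun w => hs _ (totalDegree_toPoly_le _ _ _ _)) (span_range_bcV R n k) (tensorPart I k)
      (degreeLEPart I k) (fun t ht => ?_) (fun f hf => ?_) y hy
    · rw [LinearMap.mem_ker] at ht
      simp [tensorPart, ht]
    · change toPoly ℤ_[p] n k (s f) ∈ I
      rw [hs f hf.2]
      exact hf.1

variable {I}

theorem map_actV_span_bcV_le [Module.Flat ℤ_[p] (MvPolynomial (Fin n × Fin n) ℤ_[p] ⧸ I)]
    (hmul : ∀ (R : Type u) [CommRing R] [Algebra ℤ_[p] R]
      (m m' : Matrix (Fin n) (Fin n) R), Gmem I R m → Gmem I R m' → Gmem I R (m * m'))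
    {R : Type*} [CommRing R] [Algebra ℤ_[p] R] {g : Matrix (Fin n) (Fin n) R} (hg : Gmem I R g) :
    Submodule.map (actV R n k g)
        (Submodule.span R (bcV (p := p) R n k '' (tensorPart I k : Set _))) ≤
      Submodule.span R (bcV (p := p) R n k '' (tensorPart I k : Set _)) := by
  rw [Submodule.map_le_iff_le_comap]
  intro y hy
  rw [Submodule.mem_comap]
  rw [mem_span_bcV_tensorPart_iff] at hy ⊢
  rw [toPoly_actV]
  suffices h : Submodule.span R (map (algebraMap ℤ_[p] R) '' (degreeLEPart I k : Set _)) ≤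
      (Submodule.span R (map (algebraMap ℤ_[p] R) '' (degreeLEPart I k : Set _))).comap
        (rightTranslate g).toLinearMap from h hy
  rw [Submodule.span_le]
  rintro _ ⟨f, hf, rfl⟩
  exact rightTranslate_mem_span hmul hg hf

theorem gmem_of_map_actV_span_bcV_le {R : Type*} [CommRing R] [Algebra ℤ_[p] R]
    (hone : Gmem I R (1 : Matrix (Fin n) (Fin n) R))
    (hk : Ideal.span (degreeLEPart I k : Set (MvPolynomial (Fin n × Fin n) ℤ_[p])) = I)
    {g : Matrix (Fin n) (Fin n) R}
    (hg : Submodule.map (actV R n k g)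
        (Submodule.span R (bcV (p := p) R n k '' (tensorPart I k : Set _))) ≤
      Submodule.span R (bcV (p := p) R n k '' (tensorPart I k : Set _))) :
    Gmem I R g := by
  suffices h : I ≤ RingHom.ker (aeval fun ij : Fin n × Fin n => g ij.1 ij.2) from
    fun f hf => h hf
  conv_lhs => rw [← hk]
  rw [Ideal.span_le]
  intro f hf
  obtain ⟨s, -, hs, -⟩ := exists_section_toPoly (p := p) R n k
  have hsf : s f ∈ tensorPart I k := by
    change toPoly ℤ_[p] n k (s f) ∈ I
    rw [hs f hf.2]
    exact hf.1
  have h := hg (Submodule.mem_map_of_mem (Submodule.subset_span ⟨s f, hsf, rfl⟩))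
  rw [mem_span_bcV_tensorPart_iff, toPoly_actV, toPoly_bcV, hs f hf.2] at h
  have hle : Submodule.span R (map (algebraMap ℤ_[p] R) '' (degreeLEPart I k : Set _)) ≤
      LinearMap.ker (aeval fun ij : Fin n × Fin n =>
        (1 : Matrix (Fin n) (Fin n) R) ij.1 ij.2).toLinearMap := by
    rw [Submodule.span_le]
    rintro _ ⟨f, hf, rfl⟩
    have := hone f hf.1
    rw [SetLike.mem_coe, LinearMap.mem_ker, AlgHom.toLinearMap_apply, aeval_map_algebraMap]
    exact this
  have h₁ := hle h
  rw [LinearMap.mem_ker, AlgHom.toLinearMap_apply, rightTranslate_eval_one] at h₁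
  exact h₁

end TensorPart

/-- Let `p` be an odd prime, `n ≥ 1` and `I ⊆ ℤ_[p][X_{ij}]` an ideal with
flat quotient defining a subgroup scheme `G` of `GL_n`.  Then there exist `k ∈ ℕ` and a
`ℤ_[p]`-submodule `E` of `⊕_{0≤i≤k} ((ℤ_[p]^n)^{⊕n})^{⊗i}` which is a direct summand, is
stable under the action of `G(ℤ_[p])`, and such that for every commutative `ℤ_[p]`-algebra `R`
and every `g ∈ GL_n(R)`:  `g ∈ G(R)` iff the automorphism of `⊕_{0≤i≤k} ((R^n)^{⊕n})^{⊗i}`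
induced by `g` maps the `R`-submodule generated by the image of `E` onto itself. -/
theorem exists_tensor_module_defining_group {p : ℕ} [Fact p.Prime] (hp : Odd p)
    {n : ℕ} (hn : 1 ≤ n) (I : Ideal (MvPolynomial (Fin n × Fin n) ℤ_[p]))
    (hflat : Module.Flat ℤ_[p] (MvPolynomial (Fin n × Fin n) ℤ_[p] ⧸ I))
    (hunit : ∀ (R : Type u) [CommRing R] [Algebra ℤ_[p] R]
      (m : Matrix (Fin n) (Fin n) R), Gmem I R m → IsUnit m)
    (hone : ∀ (R : Type u) [CommRing R] [Algebra ℤ_[p] R],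
      Gmem I R (1 : Matrix (Fin n) (Fin n) R))
    (hmul : ∀ (R : Type u) [CommRing R] [Algebra ℤ_[p] R]
      (m m' : Matrix (Fin n) (Fin n) R), Gmem I R m → Gmem I R m' → Gmem I R (m * m'))
    (hinv : ∀ (R : Type u) [CommRing R] [Algebra ℤ_[p] R]
      (m : Matrix (Fin n) (Fin n) R), Gmem I R m → Gmem I R m⁻¹) :
    ∃ (k : ℕ)
      (E : Submodule ℤ_[p] (⨁ i : Fin (k + 1), ⨂[ℤ_[p]]^(i : ℕ) (Fin n → Fin n → ℤ_[p]))),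
      (∃ C, IsCompl E C)
        ∧ (∀ m : Matrix (Fin n) (Fin n) ℤ_[p], Gmem I ℤ_[p] m →
            Submodule.map (actV ℤ_[p] n k m) E ≤ E)
        ∧ ∀ (R : Type u) [CommRing R] [Algebra ℤ_[p] R]
            (g : Matrix.GeneralLinearGroup (Fin n) R),
            Gmem I R (↑g : Matrix (Fin n) (Fin n) R) ↔
              Submodule.map (actV R n k (↑g : Matrix (Fin n) (Fin n) R))
                  (Submodule.span R (⇑(bcV (p := p) R n k) '' (E : Set _))) =
                Submodule.span R (⇑(bcV (p := p) R n k) '' (E : Set _)) := by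
  obtain ⟨k, hk⟩ := exists_degreeLEPart_generates I
  refine ⟨k, tensorPart I k, exists_isCompl_tensorPart I k, fun m hm => ?_, fun R _ _ g => ?_⟩
  · have hid : ⇑(bcV (p := p) ℤ_[p] n k) = id := funext (bcV_self n k)
    simpa [hid] using map_actV_span_bcV_le k hmul hm
  · refine ⟨fun hg => le_antisymm (map_actV_span_bcV_le k hmul hg) fun y hy => ?_,
      fun hg => gmem_of_map_actV_span_bcV_le k (hone R) hk hg.le⟩
    refine ⟨actV R n k (g : Matrix (Fin n) (Fin n) R)⁻¹ y,
      map_actV_span_bcV_le k hmul (hinv R _ hg) (Submodule.mem_map_of_mem hy), ?_⟩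
    rw [← actV_mul, Matrix.mul_nonsing_inv _ (Matrix.isUnits_det_units g), actV_one]
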